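/- Assume the mechanical setting, and let X_{H,M}(x) := DΓ(x) · X_H(x) for x ∈ M×ℝ. Let f : ℝⁿ × ℝⁿ × ℝ → ℝ be smooth and satisfy the mechanical condition: for every x = (q,p,z) ∈ M×ℝ, the p-gradient ∇_p f(x) := (∂f/∂p₁(x), …, ∂f/∂pₙ(x)) lies in D(q). Then for every x ∈ M×ℝ, df(x)(X_{H,M}(x)) = df(x)(X_H(x)); that is, the evolution of f in the nonholonomic system coincides with its evolution in the unconstrained system: X_{H,M}(f) = X_H(f) on M×ℝ. -/

import Mathlib

open scoped BigOperators Matrix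
noncomputable section

/-- Phase space `ℝⁿ × ℝⁿ × ℝ`, modeling `T*Q × ℝ` for `Q = ℝⁿ`. -/
abbrev PS (n : ℕ) := (Fin n → ℝ) × (Fin n → ℝ) × ℝ

/-- Partial derivative in the `qⁱ` direction. -/
def pdq {n : ℕ} (F : PS n → ℝ) (x : PS n) (i : Fin n) : ℝ :=
  fderiv ℝ F x (Pi.single i 1, 0, 0)

/-- Partial derivative in the `pᵢ` direction. -/
def pdp {n : ℕ} (F : PS n → ℝ) (x : PS n) (i : Fin n) : ℝ :=
  fderiv ℝ F x (0, Pi.single i 1, 0)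

/-- Partial derivative in the `z` direction. -/
def pdz {n : ℕ} (F : PS n → ℝ) (x : PS n) : ℝ :=
  fderiv ℝ F x (0, 0, 1)

/-- The flat map `♭ₓ(v) = ι_v dη + η(v) η` at `x = (q,p,z)`, for `η = dz − Σ pᵢ dqⁱ`;
covectors are identified with triples (dq-components, dp-components, dz-component). -/
def flatMap {n : ℕ} (x : PS n) (v : PS n) : PS n :=
  (fun i => -v.2.1 i - (v.2.2 - ∑ j, x.2.1 j * v.1 j) * x.2.1 i,
   v.1,
   v.2.2 - ∑ j, x.2.1 j * v.1 j)

/-- The contact Hamiltonian vector field of `F`. -/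
def XH {n : ℕ} (F : PS n → ℝ) (x : PS n) : PS n :=
  (fun i => pdp F x i,
   fun i => -pdq F x i - x.2.1 i * pdz F x,
   (∑ i, x.2.1 i * pdp F x i) - F x)

/-- The contact (Jacobi) bracket. -/
def jacB {n : ℕ} (f g : PS n → ℝ) (x : PS n) : ℝ :=
  (∑ i, (pdp f x i * pdq g x i - pdp g x i * pdq f x i))
  + (∑ i, x.2.1 i * (pdp f x i * pdz g x - pdp g x i * pdz f x))
  + g x * pdz f x - f x * pdz g x

/-- The differential of `F` at `x`, as a covector triple. -/
def dCov {n : ℕ} (F : PS n → ℝ) (x : PS n) : PS n :=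
  (fun i => pdq F x i, fun i => pdp F x i, pdz F x)

/-- The contact form `η = dz − Σ pᵢ dqⁱ` at `x`, as a covector triple. -/
def etaCov {n : ℕ} (x : PS n) : PS n :=
  (fun i => -x.2.1 i, 0, 1)

/-- The mechanical setting: a smooth Riemannian metric `G` on `ℝⁿ`, a smooth potential `V`,
and a smooth fiberwise projection `P` (idempotent, `G⁻¹`-symmetric) onto the constraint
subbundle along the annihilator of the constraint distribution. -/
structure MechSetting (n : ℕ) where
  hn : 1 ≤ n
  G : (Fin n → ℝ) → Matrix (Fin n) (Fin n) ℝ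
  V : (Fin n → ℝ) × ℝ → ℝ
  P : (Fin n → ℝ) → Matrix (Fin n) (Fin n) ℝ
  G_smooth : ∀ i j, ContDiff ℝ (⊤ : ℕ∞) (fun q => G q i j)
  G_symm : ∀ q, (G q).IsSymm
  G_posdef : ∀ q, (G q).PosDef
  V_smooth : ContDiff ℝ (⊤ : ℕ∞) V
  P_smooth : ∀ i j, ContDiff ℝ (⊤ : ℕ∞) (fun q => P q i j)
  P_proj : ∀ q, P q * P q = P q
  P_symm : ∀ q, (P q)ᵀ * (G q)⁻¹ = (G q)⁻¹ * P q

namespace MechSetting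

variable {n : ℕ} (S : MechSetting n)

/-- The mechanical Hamiltonian `H(q,p,z) = ½ pᵀ G(q)⁻¹ p + V(q,z)`. -/
def H (x : PS n) : ℝ :=
  (1 / 2) * (∑ i, ∑ j, x.2.1 i * (S.G x.1)⁻¹ i j * x.2.1 j) + S.V (x.1, x.2.2)

/-- The projection `Γ(q,p,z) = (q, P(q)p, z)` onto `M×ℝ`. -/
def Gam (x : PS n) : PS n :=
  (x.1, (S.P x.1).mulVec x.2.1, x.2.2)

/-- Membership in the constraint submanifold `M×ℝ = {(q,p,z) : P(q)p = p}`. -/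
def onM (x : PS n) : Prop :=
  (S.P x.1).mulVec x.2.1 = x.2.1

/-- The constraint distribution `D(q) = {G(q)⁻¹ m : P(q) m = m}`. -/
def Dd (q : Fin n → ℝ) : Set (Fin n → ℝ) :=
  {v | ∃ m, (S.P q).mulVec m = m ∧ v = ((S.G q)⁻¹).mulVec m}

/-- Entrywise partial derivative `∂P/∂qⁱ` of the matrix-valued map `P`. -/
def dP (q : Fin n → ℝ) (i : Fin n) : Matrix (Fin n) (Fin n) ℝ :=
  fun j k => fderiv ℝ (fun q' => S.P q' j k) q (Pi.single i 1)

end MechSetting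

/-- The annihilator `D° = {α ∈ ℝⁿ : Σᵢ αᵢ vᵢ = 0 for all v ∈ D}` of a subspace `D ⊆ ℝⁿ`. -/
def annih {n : ℕ} (D : Submodule ℝ (Fin n → ℝ)) : Submodule ℝ (Fin n → ℝ) where
  carrier := {α | ∀ v ∈ D, ∑ i, α i * v i = 0}
  zero_mem' := by intro v hv; simp
  add_mem' := by
    intro a b ha hb v hv
    have h1 := ha v hv
    have h2 := hb v hv
    simp only [Pi.add_apply, add_mul, Finset.sum_add_distrib, h1, h2, add_zero]
  smul_mem' := by
    intro c a ha v hv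
    simp only [Pi.smul_apply, smul_eq_mul, mul_assoc, ← Finset.mul_sum, ha v hv, mul_zero]

namespace MechSetting

variable {n : ℕ} (S : MechSetting n)

theorem differentiable_Gam : Differentiable ℝ S.Gam := by
  have hP : ∀ i j, Differentiable ℝ (fun q => S.P q i j) :=
    fun i j => (S.P_smooth i j).differentiable (by simp)
  refine differentiable_fst.prodMk (Differentiable.prodMk ?_ (by fun_prop))
  refine differentiable_pi.2 fun i => ?_
  simp only [Matrix.mulVec, dotProduct]
  refine Differentiable.fun_sum fun j _ => ?_
  exact ((hP i j).comp differentiable_fst).mul (by fun_prop)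

theorem Gam_comp_Gam : S.Gam ∘ S.Gam = S.Gam := by
  funext x
  simp [Gam, S.P_proj]

theorem Gam_eq_self {x : PS n} (hx : S.onM x) : S.Gam x = x :=
  Prod.ext rfl (Prod.ext hx rfl)

/-- The derivative of `Γ` preserves the `dq`-component. -/
theorem fderiv_Gam_fst (x X : PS n) : (fderiv ℝ S.Gam x X).1 = X.1 := by
  have h := (S.differentiable_Gam x).hasFDerivAt.fst.unique
    (hasFDerivAt_fst (𝕜 := ℝ) (p := x))
  exact congrArg (fun L => L X) h

/-- The derivative of `Γ` preserves the `dz`-component. -/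
theorem fderiv_Gam_snd_snd (x X : PS n) : (fderiv ℝ S.Gam x X).2.2 = X.2.2 := by
  have h := (S.differentiable_Gam x).hasFDerivAt.snd.snd.unique
    (hasFDerivAt_snd (𝕜 := ℝ) (p := x)).snd
  exact congrArg (fun L => L X) h

/-- On vertical vectors the derivative of `Γ` acts by `P`. -/
theorem fderiv_Gam_vertical (x : PS n) (u : Fin n → ℝ) :
    fderiv ℝ S.Gam x (0, u, 0) = (0, (S.P x.1).mulVec u, 0) := by
  have h1 := (S.differentiable_Gam x).hasFDerivAt.hasLineDerivAt (0, u, 0)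
  have h2 : HasLineDerivAt ℝ S.Gam (0, (S.P x.1).mulVec u, 0) x (0, u, 0) := by
    have hline : (fun t : ℝ => S.Gam (x + t • ((0, u, 0) : PS n))) =
        fun t : ℝ => S.Gam x + t • ((0, (S.P x.1).mulVec u, 0) : PS n) := by
      funext t
      simp [Gam, Matrix.mulVec_add, Matrix.mulVec_smul]
    rw [HasLineDerivAt, hline]
    simpa using ((hasDerivAt_id (0 : ℝ)).smul_const
      ((0, (S.P x.1).mulVec u, 0) : PS n)).const_add (S.Gam x)
  exact HasDerivAt.unique h1 h2

/-- At points of `M × ℝ` the derivative of `Γ` is idempotent. -/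
theorem fderiv_Gam_idem {x : PS n} (hx : S.onM x) (X : PS n) :
    fderiv ℝ S.Gam x (fderiv ℝ S.Gam x X) = fderiv ℝ S.Gam x X := by
  have h := fderiv_comp x (S.differentiable_Gam (S.Gam x)) (S.differentiable_Gam x)
  rw [S.Gam_comp_Gam, S.Gam_eq_self hx] at h
  exact (congrArg (fun L => L X) h).symm

/-- Vectors in the kernel of `P` are annihilated by the constraint distribution. -/
theorem dotProduct_eq_zero_of_mem_Dd {q u v : Fin n → ℝ} (hu : (S.P q).mulVec u = 0)
    (hv : v ∈ S.Dd q) : v ⬝ᵥ u = 0 := by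
  obtain ⟨m, hm, rfl⟩ := hv
  rw [← hm, Matrix.mulVec_mulVec, ← S.P_symm, ← Matrix.mulVec_mulVec, Matrix.mulVec_transpose,
    ← Matrix.dotProduct_mulVec, hu, dotProduct_zero]

end MechSetting

theorem fderiv_vertical {n : ℕ} (F : PS n → ℝ) (x : PS n) (u : Fin n → ℝ) :
    fderiv ℝ F x (0, u, 0) = (fun i => pdp F x i) ⬝ᵥ u := by
  have hu : ((0, u, 0) : PS n) =
      ∑ i, u i • ((0, Pi.single i (1 : ℝ), 0) : PS n) := by
    refine Prod.ext ?_ (Prod.ext ?_ ?_)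
    · simp [Prod.fst_sum]
    · simp only [Prod.snd_sum, Prod.fst_sum, Prod.smul_mk]
      exact pi_eq_sum_univ' u
    · simp [Prod.snd_sum]
  rw [hu, map_sum]
  simp only [map_smul, smul_eq_mul, dotProduct, pdp, mul_comm]

/-- for observables satisfying the mechanical condition, the nonholonomic
evolution coincides with the unconstrained evolution: `X_{H,M}(f) = X_H(f)` on `M×ℝ`. -/
theorem statement_17 {n : ℕ} (S : MechSetting n)
    (f : PS n → ℝ) (hf : ContDiff ℝ (⊤ : ℕ∞) f)
    (hmech : ∀ x : PS n, S.onM x → (fun i => pdp f x i) ∈ S.Dd x.1) :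
    ∀ x : PS n, S.onM x →
      fderiv ℝ f x (fderiv ℝ S.Gam x (XH S.H x)) = fderiv ℝ f x (XH S.H x) := by
  intro x hx
  set X := XH S.H x
  set u := (fderiv ℝ S.Gam x X - X).2.1
  have hvert : fderiv ℝ S.Gam x X - X = (0, u, 0) := by
    refine Prod.ext ?_ (Prod.ext rfl ?_)
    · simp [S.fderiv_Gam_fst]
    · simp [S.fderiv_Gam_snd_snd]
  have hker : (S.P x.1).mulVec u = 0 := by
    have h := S.fderiv_Gam_vertical x u
    rw [← hvert, map_sub, S.fderiv_Gam_idem hx, sub_self] at h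
    exact (congrArg (fun w : PS n => w.2.1) h).symm
  rw [← sub_eq_zero, ← map_sub, hvert, fderiv_vertical]
  exact S.dotProduct_eq_zero_of_mem_Dd hker (hmech x hx)
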